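/- For a ring A, the big finitistic dimension Fin.dim A equals 0 if and only if A is right perfect and the small finitistic dimension fin.dim A equals 0. -/

import Mathlib

set_option linter.unusedSectionVars false
set_option synthInstance.maxHeartbeats 1000000
set_option maxHeartbeats 1600000
set_option linter.unusedVariables false
set_option linter.unnecessarySeqFocus false

universe u
open MulOpposite Function DirectSum

/-! ### Lower triangular matrix rings -/

/-- The lower triangular matrix ring `[[A,0],[M,B]]` for a `B`-`A`-bimodule `M`
(a left `B`-module with a commuting right `A`-action, the latter written as a
left `Aᵐᵒᵖ`-action). The element `⟨a, m, b⟩` represents the matrix `[[a,0],[m,b]]`. -/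
@[ext] structure Tri (A B M : Type u) : Type u where
  a : A
  m : M
  b : B

namespace Tri
variable {A B M : Type u} [Ring A] [Ring B] [AddCommGroup M]
  [Module B M] [Module Aᵐᵒᵖ M] [SMulCommClass B Aᵐᵒᵖ M]

instance : Zero (Tri A B M) := ⟨⟨0, 0, 0⟩⟩
instance : Add (Tri A B M) := ⟨fun x y => ⟨x.a + y.a, x.m + y.m, x.b + y.b⟩⟩
instance : Neg (Tri A B M) := ⟨fun x => ⟨-x.a, -x.m, -x.b⟩⟩
instance : One (Tri A B M) := ⟨⟨1, 0, 1⟩⟩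
instance : Mul (Tri A B M) :=
  ⟨fun x y => ⟨x.a * y.a, op y.a • x.m + x.b • y.m, x.b * y.b⟩⟩

@[simp] lemma zero_a : (0 : Tri A B M).a = 0 := rfl
@[simp] lemma zero_m : (0 : Tri A B M).m = 0 := rfl
@[simp] lemma zero_b : (0 : Tri A B M).b = 0 := rfl
@[simp] lemma add_a (x y : Tri A B M) : (x + y).a = x.a + y.a := rfl
@[simp] lemma add_m (x y : Tri A B M) : (x + y).m = x.m + y.m := rfl
@[simp] lemma add_b (x y : Tri A B M) : (x + y).b = x.b + y.b := rfl
@[simp] lemma neg_a (x : Tri A B M) : (-x).a = -x.a := rfl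
@[simp] lemma neg_m (x : Tri A B M) : (-x).m = -x.m := rfl
@[simp] lemma neg_b (x : Tri A B M) : (-x).b = -x.b := rfl
@[simp] lemma one_a : (1 : Tri A B M).a = 1 := rfl
@[simp] lemma one_m : (1 : Tri A B M).m = 0 := rfl
@[simp] lemma one_b : (1 : Tri A B M).b = 1 := rfl
@[simp] lemma mul_a (x y : Tri A B M) : (x * y).a = x.a * y.a := rfl
@[simp] lemma mul_m (x y : Tri A B M) : (x * y).m = op y.a • x.m + x.b • y.m := rfl
@[simp] lemma mul_b (x y : Tri A B M) : (x * y).b = x.b * y.b := rfl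

instance : AddCommGroup (Tri A B M) where
  add_assoc x y z := by ext <;> simp [add_assoc]
  zero_add x := by ext <;> simp
  add_zero x := by ext <;> simp
  add_comm x y := by ext <;> simp [add_comm]
  neg_add_cancel x := by ext <;> simp
  nsmul := nsmulRec
  zsmul := zsmulRec

instance : Ring (Tri A B M) :=
  { (inferInstance : AddCommGroup (Tri A B M)),
    (inferInstance : Mul (Tri A B M)),
    (inferInstance : One (Tri A B M)) with
    left_distrib := fun x y z => by
      ext <;> simp [mul_add, smul_add, add_smul] <;> abel
    right_distrib := fun x y z => by
      ext <;> simp [add_mul, smul_add, add_smul] <;> abel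
    zero_mul := fun x => by ext <;> simp
    mul_zero := fun x => by ext <;> simp
    mul_assoc := fun x y z => by
      refine Tri.ext (mul_assoc _ _ _) ?_ (mul_assoc _ _ _)
      simp only [mul_m, mul_b, mul_a, smul_add, op_mul, mul_smul]
      rw [smul_comm x.b (op z.a) y.m]
      abel
    one_mul := fun x => by ext <;> simp
    mul_one := fun x => by ext <;> simp }

end Tri

/-! ### Corner rings -/

/-- The corner ring `eΛe` of a ring `Λ` at an idempotent `e`, with unit `e`. -/
def Corner {Λ : Type u} [Ring Λ] (e : Λ) (_ : IsIdempotentElem e) : Type u :=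
  {x : Λ // e * x = x ∧ x * e = x}

namespace Corner
variable {Λ : Type u} [Ring Λ] {e : Λ} {he : IsIdempotentElem e}

instance : Zero (Corner e he) := ⟨⟨0, by simp, by simp⟩⟩
instance : Add (Corner e he) :=
  ⟨fun x y => ⟨x.1 + y.1, by rw [mul_add, x.2.1, y.2.1], by rw [add_mul, x.2.2, y.2.2]⟩⟩
instance : Neg (Corner e he) :=
  ⟨fun x => ⟨-x.1, by rw [mul_neg, x.2.1], by rw [neg_mul, x.2.2]⟩⟩
instance : Mul (Corner e he) :=
  ⟨fun x y => ⟨x.1 * y.1, by rw [← mul_assoc, x.2.1], by rw [mul_assoc, y.2.2]⟩⟩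
instance : One (Corner e he) := ⟨⟨e, he, he⟩⟩

instance : Ring (Corner e he) where
  add_assoc x y z := Subtype.ext (add_assoc _ _ _)
  zero_add x := Subtype.ext (zero_add _)
  add_zero x := Subtype.ext (add_zero _)
  add_comm x y := Subtype.ext (add_comm _ _)
  neg_add_cancel x := Subtype.ext (neg_add_cancel _)
  nsmul := nsmulRec
  zsmul := zsmulRec
  left_distrib x y z := Subtype.ext (mul_add _ _ _)
  right_distrib x y z := Subtype.ext (add_mul _ _ _)
  zero_mul x := Subtype.ext (zero_mul _)
  mul_zero x := Subtype.ext (mul_zero _)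
  mul_assoc x y z := Subtype.ext (mul_assoc _ _ _)
  one_mul x := Subtype.ext x.2.1
  mul_one x := Subtype.ext x.2.2

end Corner

/-! ### Projective dimension and finitistic dimensions -/

/-- `pdLE R n M` : `M` has projective dimension at most `n` as a left `R`-module. -/
def pdLE (R : Type u) [Ring R] : (n : ℕ) → (M : Type u) → [AddCommGroup M] → [Module R M] → Prop
  | 0, M, _, _ => Module.Projective R M
  | n+1, M, _, _ => ∃ (P : Type u) (_ : AddCommGroup P) (_ : Module R P),
      Module.Projective R P ∧
      ∃ f : P →ₗ[R] M, Function.Surjective f ∧ pdLE R n (LinearMap.ker f)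

/-- The projective dimension of a left `R`-module, as an element of `ℕ∞`
(with value `⊤` when no finite projective resolution exists). -/
noncomputable def projDim (R : Type u) [Ring R] (M : Type u) [AddCommGroup M] [Module R M] : ℕ∞ :=
  sInf {d : ℕ∞ | ∃ n : ℕ, d = n ∧ pdLE R n M}

/-- `fgpdLE R n M` : `M` admits a resolution of length at most `n` by finitely
generated projective left `R`-modules. -/
def fgpdLE (R : Type u) [Ring R] :
    (n : ℕ) → (M : Type u) → [AddCommGroup M] → [Module R M] → Prop
  | 0, M, _, _ => Module.Projective R M ∧ Module.Finite R M
  | n+1, M, _, _ => ∃ (P : Type u) (_ : AddCommGroup P) (_ : Module R P),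
      (Module.Projective R P ∧ Module.Finite R P) ∧
      ∃ f : P →ₗ[R] M, Function.Surjective f ∧ fgpdLE R n (LinearMap.ker f)

/-- The small finitistic dimension of `R`, computed with *left* `R`-modules: the
supremum of the projective dimensions of the left modules admitting a finite
resolution by finitely generated projectives. -/
noncomputable def smallFinDimLeft (R : Type u) [Ring R] : ℕ∞ :=
  sSup {d : ℕ∞ | ∃ (M : Type u) (_ : AddCommGroup M) (_ : Module R M),
    (∃ n : ℕ, fgpdLE R n M) ∧ projDim R M = d}

/-- The big finitistic dimension of `R`, computed with *left* `R`-modules: the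
supremum of all finite projective dimensions of left `R`-modules. -/
noncomputable def bigFinDimLeft (R : Type u) [Ring R] : ℕ∞ :=
  sSup {d : ℕ∞ | d ≠ ⊤ ∧ ∃ (M : Type u) (_ : AddCommGroup M) (_ : Module R M),
    projDim R M = d}

/-- `fin.dim R` : the small finitistic dimension of `R`, computed with right
`R`-modules (= left `Rᵐᵒᵖ`-modules). -/
noncomputable def finDim (R : Type u) [Ring R] : ℕ∞ := smallFinDimLeft Rᵐᵒᵖ

/-- `Fin.dim R` : the big finitistic dimension of `R`, computed with right
`R`-modules (= left `Rᵐᵒᵖ`-modules). -/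
noncomputable def bigFinDim (R : Type u) [Ring R] : ℕ∞ := bigFinDimLeft Rᵐᵒᵖ

/-! ### Radical, socle, perfect and semilocal rings, Morita equivalence -/

/-- The radical of a module: the intersection of all maximal submodules. -/
def moduleRad (R M : Type u) [Ring R] [AddCommGroup M] [Module R M] : Submodule R M :=
  sInf {N : Submodule R M | IsCoatom N}

/-- The socle of a module: the sum of all simple submodules. -/
def moduleSoc (R M : Type u) [Ring R] [AddCommGroup M] [Module R M] : Submodule R M :=
  sSup {N : Submodule R M | IsSimpleModule R ↥N}

/-- A ring is right perfect if every right module has a projective cover,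
i.e. a superfluous epimorphism from a projective module. -/
def IsRightPerfect (R : Type u) [Ring R] : Prop :=
  ∀ (M : Type u) (_ : AddCommGroup M) (_ : Module Rᵐᵒᵖ M),
    ∃ (P : Type u) (_ : AddCommGroup P) (_ : Module Rᵐᵒᵖ P) (f : P →ₗ[Rᵐᵒᵖ] M),
      Module.Projective Rᵐᵒᵖ P ∧ Function.Surjective f ∧
      ∀ N : Submodule Rᵐᵒᵖ P, N ⊔ LinearMap.ker f = ⊤ → N = ⊤

/-- A ring is left perfect if every left module has a projective cover. -/
def IsLeftPerfect (R : Type u) [Ring R] : Prop :=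
  ∀ (M : Type u) (_ : AddCommGroup M) (_ : Module R M),
    ∃ (P : Type u) (_ : AddCommGroup P) (_ : Module R P) (f : P →ₗ[R] M),
      Module.Projective R P ∧ Function.Surjective f ∧
      ∀ N : Submodule R P, N ⊔ LinearMap.ker f = ⊤ → N = ⊤

/-- A ring is semilocal if its quotient by the Jacobson radical is semisimple;
equivalently, there is a surjective ring homomorphism onto a semisimple ring
whose kernel is the Jacobson radical. -/
def IsSemilocal (A : Type u) [Ring A] : Prop :=
  ∃ (T : Type u) (_ : Ring T) (f : A →+* T), Function.Surjective f ∧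
    IsSemisimpleRing T ∧ RingHom.ker f = (⊥ : Ideal A).jacobson

/-- Morita equivalence, via the categories of right modules. -/
def MoritaEquiv (R S : Type u) [Ring R] [Ring S] : Prop :=
  Nonempty (ModuleCat.{u} Rᵐᵒᵖ ≌ ModuleCat.{u} Sᵐᵒᵖ)

/-- Powers of an additive subgroup of a ring (e.g. of the Jacobson radical of a
not necessarily commutative ring), defined via products. -/
def addSubgroupPow {R : Type u} [Ring R] (I : AddSubgroup R) : ℕ → AddSubgroup R
  | 0 => ⊤
  | 1 => I
  | n+2 => AddSubgroup.closure {x : R | ∃ p ∈ I, ∃ q ∈ addSubgroupPow I (n+1), x = p * q}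

/-- Left multiplication by a fixed element, as an endomorphism of the right
regular module. -/
def leftMulHom (R : Type u) [Ring R] (z : R) : R →ₗ[Rᵐᵒᵖ] R where
  toFun x := z * x
  map_add' := mul_add z
  map_smul' r x := (mul_assoc z x r.unop).symm

/-! ### The asymmetric cover -/

/-- The endomorphism ring of the right `A`-module `S i`. -/
abbrev EndS (A : Type u) [Ring A] {ι : Type u} (S : ι → Type u)
    [∀ i, AddCommGroup (S i)] [∀ i, Module Aᵐᵒᵖ (S i)] (i : ι) : Type u :=
  Module.End Aᵐᵒᵖ (S i)

/-- `Ā = ∏_{S ∈ Σ(A)} T(End_A(S))`, the product over the simple right `A`-modules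
of the trivial extensions of their endomorphism rings. -/
abbrev Abar (A : Type u) [Ring A] {ι : Type u} (S : ι → Type u)
    [∀ i, AddCommGroup (S i)] [∀ i, Module Aᵐᵒᵖ (S i)] : Type u :=
  ∀ i, TrivSqZeroExt (EndS A S i) (EndS A S i)

/-- `S̄ = ⊕_{S ∈ Σ(A)} S`, the direct sum of the simple right `A`-modules. -/
abbrev Sbar (A : Type u) [Ring A] {ι : Type u} (S : ι → Type u)
    [∀ i, AddCommGroup (S i)] [∀ i, Module Aᵐᵒᵖ (S i)] : Type u :=
  ⨁ i, S i

/-- The canonical projection `T(B) → B` from a trivial extension, as a ring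
homomorphism. -/
def tszeFst (B : Type u) [Ring B] : TrivSqZeroExt B B →+* B where
  toFun x := x.fst
  map_one' := rfl
  map_mul' _ _ := rfl
  map_zero' := rfl
  map_add' _ _ := rfl

section
variable (A : Type u) [Ring A] {ι : Type u} (S : ι → Type u)
  [∀ i, AddCommGroup (S i)] [∀ i, Module Aᵐᵒᵖ (S i)]

/-- The left `Ā`-action on each simple module `S i`, via `Ā → T(End_A(S i)) → End_A(S i)`. -/
instance instModuleAbarS (i : ι) : Module (Abar A S) (S i) where
  smul r x := (r i).fst x
  one_smul x := rfl
  mul_smul r s x := rfl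
  smul_zero r := map_zero _
  smul_add r x y := map_add _ x y
  add_smul r s x := LinearMap.add_apply _ _ _
  zero_smul x := rfl

lemma abar_smul_def (r : Abar A S) (i : ι) (x : S i) : r • x = (r i).fst x := rfl

instance instSMulCommAbarS (i : ι) : SMulCommClass (Abar A S) Aᵐᵒᵖ (S i) where
  smul_comm r a x := map_smul ((r i).fst) a x

instance instSMulCommAbarSbar : SMulCommClass (Abar A S) Aᵐᵒᵖ (Sbar A S) where
  smul_comm r a x := by
    refine DFinsupp.ext fun i => ?_
    change r • a • x i = a • r • x i
    exact smul_comm _ _ _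

end

/-- The asymmetric cover `Ã = [[A,0],[S̄,Ā]]` of the ring `A`, relative to a
family `S : ι → Type u` of representatives of the simple right `A`-modules. -/
abbrev AsymCover (A : Type u) [Ring A] {ι : Type u} (S : ι → Type u)
    [∀ i, AddCommGroup (S i)] [∀ i, Module Aᵐᵒᵖ (S i)] : Type u :=
  Tri A (Abar A S) (Sbar A S)

/-- `S : ι → Type u` is a complete irredundant family of representatives of the
isomorphism classes of simple right `A`-modules. -/
def IsSimpleFamily (A : Type u) [Ring A] {ι : Type u} (S : ι → Type u)
    [∀ i, AddCommGroup (S i)] [∀ i, Module Aᵐᵒᵖ (S i)] : Prop :=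
  (∀ i, IsSimpleModule Aᵐᵒᵖ (S i)) ∧
  (∀ (T : Type u) (_ : AddCommGroup T) (_ : Module Aᵐᵒᵖ T),
    IsSimpleModule Aᵐᵒᵖ T → ∃ i, Nonempty (T ≃ₗ[Aᵐᵒᵖ] S i)) ∧
  (∀ i j, Nonempty (S i ≃ₗ[Aᵐᵒᵖ] S j) → i = j)

/-! ### Bass's chain condition on principal right ideals -/

/-- The descending chain condition on principal right ideals. -/
def PrincipalRightDCC (R : Type u) [Ring R] : Prop :=
  ∀ f : ℕ → R, (∀ n, ∃ c, f (n + 1) = f n * c) → ∃ n, ∀ m, ∃ c, f n = f m * c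

/-- The product `a k * a (k + 1) * ⋯ * a (k + l - 1)`. -/
def consecutiveProd {R : Type u} [Ring R] (a : ℕ → R) : ℕ → ℕ → R
  | _, 0 => 1
  | k, l + 1 => a k * consecutiveProd a (k + 1) l

lemma consecutiveProd_succ {R : Type u} [Ring R] (a : ℕ → R) (k l : ℕ) :
    consecutiveProd a k (l + 1) = consecutiveProd a k l * a (k + l) := by
  induction l generalizing k with
  | zero => simp [consecutiveProd]
  | succ l ih =>
    rw [consecutiveProd, ih, consecutiveProd, mul_assoc, Nat.add_right_comm, Nat.add_assoc k l 1]

/-- Bass's lemma: if modules of projective dimension at most one are projective, then products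
`a 0 * ⋯ * a (n - 1)` eventually generate the same right ideal. -/
lemma exists_consecutiveProd_dvd {R : Type u} [Ring R]
    (H : ∀ (M : Type u) [AddCommGroup M] [Module R M], pdLE R 1 M → Module.Projective R M)
    (a : ℕ → R) :
    ∃ n, ∀ m, ∃ c, consecutiveProd a 0 n = consecutiveProd a 0 m * c := by
  let e : ℕ → ℕ →₀ R := fun i => Finsupp.single i 1
  let h : (ℕ →₀ R) →ₗ[R] (ℕ →₀ R) := Finsupp.lift (ℕ →₀ R) R ℕ fun i => e i - a i • e (i + 1)
  have h_e (i : ℕ) : h (e i) = e i - a i • e (i + 1) := by simp [h, e]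
  have h_zero (x : ℕ →₀ R) : h x 0 = x 0 := by
    induction x using Finsupp.induction_linear with
    | zero => simp
    | add x y hx hy => simp [hx, hy]
    | single i r =>
      have : (Finsupp.single i r : ℕ →₀ R) = r • e i := by simp [e]
      rw [this, map_smul, h_e]
      simp [e, Finsupp.single_apply]
  have h_succ (x : ℕ →₀ R) (k : ℕ) : h x (k + 1) = x (k + 1) - x k * a k := by
    induction x using Finsupp.induction_linear with
    | zero => simp
    | add x y hx hy => simp [hx, hy, add_mul]; abel
    | single i r =>
      have : (Finsupp.single i r : ℕ →₀ R) = r • e i := by simp [e]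
      rw [this, map_smul, h_e]
      by_cases hik : i = k
      · subst hik; simp [e]
      · simp [e, Finsupp.single_apply, hik]
  have h_inj : Injective h := by
    rw [injective_iff_map_eq_zero]
    intro x hx
    ext k
    induction k with
    | zero => rw [← h_zero, hx]
    | succ k ih =>
      have := h_succ x k
      rw [hx, ih] at this
      simpa using this.symm
  have hproj : Module.Projective R ((ℕ →₀ R) ⧸ LinearMap.range h) := by
    refine H _ ⟨ℕ →₀ R, inferInstance, inferInstance, inferInstance, (LinearMap.range h).mkQ,
      Submodule.mkQ_surjective _, ?_⟩
    change Module.Projective R (LinearMap.ker (LinearMap.range h).mkQ)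
    rw [Submodule.ker_mkQ]
    exact Module.Projective.of_equiv (LinearEquiv.ofInjective h h_inj)
  obtain ⟨s, hs⟩ := Module.projective_lifting_property (LinearMap.range h).mkQ LinearMap.id
    (Submodule.mkQ_surjective _)
  let x : ℕ → ℕ →₀ R := fun i => s ((LinearMap.range h).mkQ (e i))
  have hx_succ (i : ℕ) : x i = a i • x (i + 1) := by
    have : (LinearMap.range h).mkQ (e i - a i • e (i + 1)) = 0 := by
      rw [← h_e]; simp
    simp only [x]
    rw [← map_smul, ← map_smul, ← sub_eq_zero, ← map_sub, ← map_sub, this, map_zero]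
  have hx (k l : ℕ) : x k = consecutiveProd a k l • x (k + l) := by
    induction l generalizing k with
    | zero => simp [consecutiveProd]
    | succ l ih =>
      rw [consecutiveProd, mul_smul, hx_succ k, ih (k + 1), Nat.add_assoc k 1 l, Nat.add_comm 1 l]
  let ψ : ℕ → (ℕ →₀ R) →ₗ[R] R := fun n =>
    Finsupp.lift R R ℕ fun k => if k ≤ n then consecutiveProd a k (n - k) else 0
  have ψ_e (n k : ℕ) : ψ n (e k) = if k ≤ n then consecutiveProd a k (n - k) else 0 := by
    simp [ψ, e]
  have ψ_h (y : ℕ →₀ R) : ∃ N, ∀ n ≥ N, ψ n (h y) = 0 := by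
    induction y using Finsupp.induction_linear with
    | zero => simp
    | add y z hy hz =>
      obtain ⟨N, hN⟩ := hy
      obtain ⟨N', hN'⟩ := hz
      refine ⟨max N N', fun n hn => ?_⟩
      rw [map_add, map_add, hN n (le_of_max_le_left hn), hN' n (le_of_max_le_right hn), add_zero]
    | single i r =>
      refine ⟨i + 1, fun n hn => ?_⟩
      have : (Finsupp.single i r : ℕ →₀ R) = r • e i := by simp [e]
      obtain ⟨l, rfl⟩ := Nat.exists_eq_add_of_le hn
      rw [this, map_smul, map_smul, h_e, map_sub, map_smul, ψ_e, ψ_e, if_pos (by omega),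
        if_pos (by omega), show i + 1 + l - i = l + 1 by omega, show i + 1 + l - (i + 1) = l by omega,
        consecutiveProd, smul_eq_mul, smul_eq_mul, sub_self, mul_zero]
  have hmem : e 0 - x 0 ∈ LinearMap.range h := by
    rw [← Submodule.ker_mkQ (LinearMap.range h), LinearMap.mem_ker, map_sub]
    have := LinearMap.congr_fun hs ((LinearMap.range h).mkQ (e 0))
    simp only [LinearMap.comp_apply, LinearMap.id_apply] at this
    rw [this, sub_self]
  obtain ⟨y, hy⟩ := hmem
  obtain ⟨N, hN⟩ := ψ_h y
  refine ⟨N, fun m => ⟨ψ N (x m), ?_⟩⟩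
  have h1 := hN N le_rfl
  rw [hy, map_sub, ψ_e, if_pos (Nat.zero_le _), Nat.sub_zero, hx 0 m, map_smul, sub_eq_zero,
    Nat.zero_add] at h1
  exact h1

lemma principalRightDCC_of_pdLE_one {R : Type u} [Ring R]
    (H : ∀ (M : Type u) [AddCommGroup M] [Module R M], pdLE R 1 M → Module.Projective R M) :
    PrincipalRightDCC R := by
  intro f hf
  choose c hc using hf
  let a : ℕ → R := fun n => Nat.casesOn n (f 0) c
  have ha (n : ℕ) : consecutiveProd a 0 (n + 1) = f n := by
    induction n with
    | zero => simp [consecutiveProd, a]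
    | succ n ih => rw [consecutiveProd_succ, ih, hc, Nat.zero_add]
  obtain ⟨n, hn⟩ := exists_consecutiveProd_dvd H a
  refine ⟨n, fun m => ?_⟩
  obtain ⟨d, hd⟩ := hn (m + 1)
  exact ⟨d * a n, by rw [← ha n, consecutiveProd_succ, hd, ha, Nat.zero_add, mul_assoc]⟩

lemma PrincipalRightDCC.exists_minimal {R : Type u} [Ring R] (h : PrincipalRightDCC R)
    (P : R → Prop) (hP : ∃ x, P x) :
    ∃ x, P x ∧ ∀ c, P (x * c) → ∃ d, x = x * c * d := by
  by_contra! hcon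
  choose! c hc hd using hcon
  obtain ⟨x₀, hx₀⟩ := hP
  let f : ℕ → R := fun n => (fun x => x * c x)^[n] x₀
  have hf (n : ℕ) : f (n + 1) = f n * c (f n) := by
    simp only [f, Function.iterate_succ_apply']
  have hPf (n : ℕ) : P (f n) := by
    induction n with
    | zero => exact hx₀
    | succ n ih => rw [hf]; exact hc _ ih
  obtain ⟨n, hn⟩ := h f fun n => ⟨_, hf n⟩
  obtain ⟨d, h1⟩ := hn (n + 1)
  exact hd _ (hPf n) d (by rw [← hf]; exact h1)

/-! ### The Jacobson radical -/

lemma exists_mul_one_sub_eq_one_of_mem_jacobson {R : Type u} [Ring R] {j : R}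
    (hj : j ∈ Ring.jacobson R) : ∃ z, z * (1 - j) = 1 := by
  have : Ideal.span {1 - j} = ⊤ := by
    by_contra hne
    obtain ⟨m, hm, hle⟩ := Ideal.exists_le_maximal _ hne
    have h1 := hle (Ideal.mem_span_singleton_self (1 - j))
    have h2 := Ring.jacobson_le_of_isMaximal m hj
    exact hm.ne_top ((Ideal.eq_top_iff_one m).2 (by simpa using m.add_mem h1 h2))
  have h1 : (1 : R) ∈ Ideal.span {1 - j} := this ▸ Submodule.mem_top
  exact Ideal.mem_span_singleton'.1 h1

lemma isUnit_one_sub_of_mem_jacobson {R : Type u} [Ring R] {j : R}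
    (hj : j ∈ Ring.jacobson R) : IsUnit (1 - j) := by
  obtain ⟨z, hz⟩ := exists_mul_one_sub_eq_one_of_mem_jacobson hj
  have hz' : z = 1 - -(z * j) := by rw [mul_sub, mul_one] at hz; rw [← hz]; abel
  obtain ⟨w, hw⟩ := exists_mul_one_sub_eq_one_of_mem_jacobson
    ((Ring.jacobson R).neg_mem ((Ring.jacobson R).mul_mem_left z hj))
  rw [← hz'] at hw
  have : w = 1 - j := left_inv_eq_right_inv hw hz
  exact ⟨⟨1 - j, z, this ▸ hw, hz⟩, rfl⟩

lemma exists_mul_mul_ne_zero_of_jacobson_eq_bot {R : Type u} [Ring R]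
    (h : Ring.jacobson R = ⊥) {z : R} (hz : z ≠ 0) : ∃ s, z * s * z ≠ 0 := by
  by_contra! hcon
  apply hz
  rw [← Submodule.mem_bot R, ← h, Ring.jacobson_eq_sInf_isMaximal, Submodule.mem_sInf]
  intro m hm
  by_contra hzm
  obtain ⟨s, y, hy, hs⟩ := Ideal.IsMaximal.exists_inv hm hzm
  apply hm.ne_top
  rw [Ideal.eq_top_iff_one]
  have h1 : (1 + s * z) * (s * z + y) = 1 + s * z := by rw [hs, mul_one]
  have h2 : y + s * z * y = 1 := by
    have h3 : s * z * (s * z) = 0 := by rw [mul_assoc, ← mul_assoc z, hcon, mul_zero]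
    have h4 : (1 + s * z) * (s * z + y) = s * z + (y + s * z * y) + s * z * (s * z) := by noncomm_ring
    rw [h4, h3, add_zero, add_comm] at h1
    exact add_right_cancel h1
  rw [← h2]
  exact m.add_mem hy (Ideal.mul_mem_left m _ hy)

/-- A semiprime ring with minimum condition on principal left ideals is semisimple. -/
lemma isSemisimpleRing_of_exists_minimal {T : Type u} [Ring T]
    (hmin : ∀ P : T → Prop, (∃ x, P x) → ∃ x, P x ∧ ∀ c, P (c * x) → ∃ d, x = d * (c * x))
    (hsemi : ∀ z : T, z ≠ 0 → ∃ s, z * s * z ≠ 0) : IsSemisimpleRing T := by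
  apply IsSemisimpleModule.of_sSup_simples_eq_top
  set soc : Submodule T T := sSup {m : Submodule T T | IsSimpleModule T m} with hsoc
  obtain ⟨y, hy, hymin⟩ := hmin (fun y => 1 - y ∈ soc) ⟨1, by simp⟩
  suffices y = 0 by
    subst this
    exact (Ideal.eq_top_iff_one soc).2 (by simpa using hy)
  by_contra hy0
  obtain ⟨z, ⟨hz0, b, rfl⟩, hzmin⟩ := hmin (fun z => z ≠ 0 ∧ ∃ b, z = b * y) ⟨y, hy0, 1, by simp⟩
  replace hzmin (c : T) (hc : c * (b * y) ≠ 0) : ∃ d, b * y = d * (c * (b * y)) :=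
    hzmin c ⟨hc, c * b, by rw [mul_assoc]⟩
  set z := b * y with hz
  have hsimple : IsSimpleModule T (Ideal.span {z}) := by
    rw [isSimpleModule_iff_isAtom]
    refine ⟨by simpa using hz0, fun I hI => ?_⟩
    by_contra hI0
    obtain ⟨w, hw, hw0⟩ := (Submodule.ne_bot_iff I).1 hI0
    obtain ⟨c, rfl⟩ := Ideal.mem_span_singleton'.1 (hI.le hw)
    obtain ⟨d, hd⟩ := hzmin c hw0
    refine hI.not_ge ((Ideal.span_singleton_le_iff_mem _).2 ?_)
    rw [hd]
    exact Ideal.mul_mem_left I _ hw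
  have hspan : Ideal.span {z} ≤ soc := le_sSup hsimple
  obtain ⟨s, hs⟩ := hsemi z hz0
  obtain ⟨t, ht⟩ := hzmin (z * s) hs
  let w := s * z
  let i := s * (t * z)
  have hiw : i * w = w := by
    simp only [i, w]
    conv_rhs => rw [ht]
    noncomm_ring
  have hii : i * i = i := by
    by_contra hne
    have h0 : (s * t * z * s * t - s * t) * z ≠ 0 := by
      intro h
      apply hne
      rw [← sub_eq_zero, ← h]
      simp only [i]
      noncomm_ring
    obtain ⟨v, hv⟩ := hzmin _ h0
    apply hs
    have h1 : (s * t * z * s * t - s * t) * z * w = 0 := by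
      have : (s * t * z * s * t - s * t) * z * w = i * (i * w) - i * w := by
        simp only [i]; noncomm_ring
      rw [this, hiw, hiw, sub_self]
    calc z * s * z = z * w := by simp only [w, mul_assoc]
      _ = v * ((s * t * z * s * t - s * t) * z) * w := by rw [← hv]
      _ = 0 := by rw [mul_assoc, h1, mul_zero]
  have hi0 : i ≠ 0 := by
    intro h
    apply hs
    rw [h, zero_mul] at hiw
    rw [mul_assoc]
    change z * w = 0
    rw [← hiw, mul_zero]
  have hzi : z * i = z := by
    have h1 : (s * t) * z ≠ 0 := by simpa only [i, mul_assoc] using hi0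
    obtain ⟨v, hv⟩ := hzmin _ h1
    have h2 : z = v * i := by rw [hv]; simp only [i, mul_assoc]
    rw [h2, mul_assoc, hii]
  have hi_mem : i ∈ Ideal.span {z} :=
    Ideal.mul_mem_left _ _ (Ideal.mul_mem_left _ _ (Ideal.mem_span_singleton_self z))
  obtain ⟨d, hd⟩ := hymin (1 - y * s * t * b) <| by
    have : 1 - (1 - y * s * t * b) * y = (1 - y) + y * i := by
      simp only [i, hz]; noncomm_ring
    rw [this]
    exact soc.add_mem hy (soc.smul_mem y (hspan hi_mem))
  have h1 : (1 - y * s * t * b) * y = y - y * i := by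
    simp only [i, hz]; noncomm_ring
  rw [h1] at hd
  have hyi : y * i = 0 := by
    rw [hd, mul_assoc, sub_mul, mul_assoc, hii, sub_self, mul_zero]
  apply hz0
  rw [← hzi, hz, mul_assoc, hyi, mul_zero]

namespace PrincipalRightDCC

variable {R : Type u} [Ring R]

lemma isSemisimpleRing_quotient (h : PrincipalRightDCC R) :
    IsSemisimpleRing (R ⧸ Ring.jacobson R) := by
  rw [← isSemisimpleRing_mulOpposite_iff]
  apply isSemisimpleRing_of_exists_minimal
  · rintro P ⟨x, hx⟩
    obtain ⟨x₀, hx₀⟩ := Ideal.Quotient.mk_surjective x.unop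
    obtain ⟨y, hy, hmin⟩ := h.exists_minimal
      (fun r => P (op (Ideal.Quotient.mk (Ring.jacobson R) r))) ⟨x₀, by rwa [hx₀]⟩
    refine ⟨_, hy, fun c hc => ?_⟩
    obtain ⟨c₀, hc₀⟩ := Ideal.Quotient.mk_surjective c.unop
    obtain rfl : op (Ideal.Quotient.mk (Ring.jacobson R) c₀) = c := by rw [hc₀]; rfl
    obtain ⟨d, hd⟩ := hmin c₀ (by rwa [map_mul, op_mul])
    refine ⟨op (Ideal.Quotient.mk (Ring.jacobson R) d), ?_⟩
    rw [← op_mul, ← op_mul, ← map_mul, ← map_mul, ← hd]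
  · intro z hz
    obtain ⟨s, hs⟩ := exists_mul_mul_ne_zero_of_jacobson_eq_bot
      (Ring.jacobson_quotient_jacobson R) (z := z.unop) (by simpa using hz)
    refine ⟨op s, fun h0 => hs ?_⟩
    have := congrArg unop h0
    simpa [mul_assoc] using this

/-- A chain of successive right multiples by elements of the Jacobson radical reaches zero. -/
lemma exists_eq_zero (h : PrincipalRightDCC R) (f : ℕ → R)
    (hf : ∀ n, ∃ c ∈ Ring.jacobson R, f (n + 1) = f n * c) : ∃ n, f n = 0 := by
  obtain ⟨n, hn⟩ := h f fun n => (hf n).imp fun _ hc => hc.2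
  obtain ⟨c, hc, hfc⟩ := hf n
  obtain ⟨d, hd⟩ := hn (n + 1)
  refine ⟨n, ?_⟩
  have hu := isUnit_one_sub_of_mem_jacobson ((Ring.jacobson R).mul_mem_right d hc)
  rw [← hu.mul_left_eq_zero, mul_sub, mul_one, ← mul_assoc, ← hfc, ← hd, sub_self]

lemma isNilpotent_of_mem_jacobson (h : PrincipalRightDCC R) {x : R}
    (hx : x ∈ Ring.jacobson R) : IsNilpotent x :=
  h.exists_eq_zero (x ^ ·) fun n => ⟨x, hx, pow_succ x n⟩

lemma subsingleton_of_jacobson_smul_top (h : PrincipalRightDCC R) {M : Type u} [AddCommGroup M]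
    [Module R M] (hM : Ring.jacobson R • (⊤ : Submodule R M) = ⊤) : Subsingleton M := by
  by_contra hne
  rw [not_subsingleton_iff_nontrivial] at hne
  have step (a : R) (ha : ∃ x : M, a • x ≠ 0) :
      ∃ j ∈ Ring.jacobson R, ∃ x : M, (a * j) • x ≠ 0 := by
    by_contra! hcon
    obtain ⟨x, hx⟩ := ha
    apply hx
    have hxm : x ∈ Ring.jacobson R • (⊤ : Submodule R M) := by rw [hM]; exact Submodule.mem_top
    refine Submodule.smul_induction_on hxm (fun j hj y _ => ?_) (fun y z hy hz => ?_)
    · rw [← mul_smul, hcon j hj]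
    · rw [smul_add, hy, hz, add_zero]
  choose! c hc hcx using step
  let f : ℕ → R := fun n => (fun x => x * c x)^[n] 1
  have hf (n : ℕ) : f (n + 1) = f n * c (f n) := by
    simp only [f, Function.iterate_succ_apply']
  have hne (n : ℕ) : ∃ x : M, f n • x ≠ 0 := by
    induction n with
    | zero => simpa [f] using exists_ne (0 : M)
    | succ n ih => rw [hf]; exact hcx _ ih
  obtain ⟨n, hn⟩ := h.exists_eq_zero f fun n => ⟨_, hc _ (hne n), hf n⟩
  obtain ⟨x, hx⟩ := hne n
  exact hx (by rw [hn, zero_smul])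

lemma eq_top_of_sup_jacobson_smul_top (h : PrincipalRightDCC R) {M : Type u} [AddCommGroup M]
    [Module R M] {N : Submodule R M} (hN : N ⊔ Ring.jacobson R • (⊤ : Submodule R M) = ⊤) :
    N = ⊤ := by
  rw [← Submodule.Quotient.subsingleton_iff]
  apply h.subsingleton_of_jacobson_smul_top
  have := congrArg (Submodule.map N.mkQ) hN
  rw [Submodule.map_sup, Submodule.mkQ_map_self, bot_sup_eq, Submodule.map_smul'',
    Submodule.map_top, Submodule.range_mkQ] at this
  exact this

end PrincipalRightDCC

/-! ### Projective covers from the chain condition -/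

/-- Every left `R`-module has a projective cover. -/
def HasProjectiveCovers (R : Type u) [Ring R] : Prop :=
  ∀ (M : Type u) (_ : AddCommGroup M) (_ : Module R M),
    ∃ (P : Type u) (_ : AddCommGroup P) (_ : Module R P) (f : P →ₗ[R] M),
      Module.Projective R P ∧ Function.Surjective f ∧
      ∀ N : Submodule R P, N ⊔ LinearMap.ker f = ⊤ → N = ⊤

namespace PrincipalRightDCC

variable {R : Type u} [Ring R]

lemma exists_projective_of_isSimpleModule (h : PrincipalRightDCC R) (M : Type u) [AddCommGroup M]
    [Module R M] [IsSimpleModule R M] :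
    ∃ (P : Type u) (_ : AddCommGroup P) (_ : Module R P) (f : P →ₗ[R] M),
      Module.Projective R P ∧ Function.Surjective f ∧
      LinearMap.ker f ≤ Ring.jacobson R • (⊤ : Submodule R P) := by
  have := IsSimpleModule.nontrivial R M
  obtain ⟨x, hx⟩ := exists_ne (0 : M)
  have hm := IsSimpleModule.ker_toSpanSingleton_isMaximal R hx
  have hsurj := IsSimpleModule.toSpanSingleton_surjective R hx
  set m : Ideal R := LinearMap.ker (LinearMap.toSpanSingleton R M x) with hm_def
  have hJm : Ring.jacobson R ≤ m := Ring.jacobson_le_of_isMaximal m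
  have mem_m (r : R) : r ∈ m ↔ r • x = 0 := by simp [hm_def]
  let π := Ideal.Quotient.mk (Ring.jacobson R)
  have hπ : Surjective π := Ideal.Quotient.mk_surjective
  have := h.isSemisimpleRing_quotient
  obtain ⟨N, hN⟩ := exists_isCompl (Ideal.map π m)
  obtain ⟨k', hk', n, hn, hkn⟩ := Submodule.mem_sup.1
    (hN.sup_eq_top ▸ Submodule.mem_top : (1 : R ⧸ Ring.jacobson R) ∈ Ideal.map π m ⊔ N)
  obtain ⟨k, hk, rfl⟩ := (Ideal.mem_map_iff_of_surjective π hπ).1 hk'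
  have hn_idem : IsIdempotentElem n := by
    have h1 : n - n * n = n * π k := by rw [← eq_sub_iff_add_eq] at hkn; rw [hkn]; noncomm_ring
    have h2 : n - n * n ∈ Ideal.map π m ⊓ N :=
      ⟨h1 ▸ Ideal.mul_mem_left _ _ hk', N.sub_mem hn (Ideal.mul_mem_left N _ hn)⟩
    rw [hN.inf_eq_bot, Submodule.mem_bot, sub_eq_zero] at h2
    exact h2.symm
  obtain ⟨e, he, hen⟩ := exists_isIdempotentElem_eq_of_ker_isNilpotent π
    (fun y hy => h.isNilpotent_of_mem_jacobson (by rwa [Ideal.mk_ker] at hy)) n (hπ n) hn_idem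
  have hex : e • x = x := by
    have h1 : e + k - 1 ∈ Ring.jacobson R := by
      rw [← Ideal.Quotient.eq_zero_iff_mem]
      change π (e + k - 1) = 0
      rw [map_sub, map_add, hen, map_one, add_comm, hkn, sub_self]
    have h2 : e - 1 ∈ m := by
      have := m.sub_mem (hJm h1) hk
      rwa [show e + k - 1 - k = e - 1 by abel] at this
    rwa [mem_m, sub_smul, one_smul, sub_eq_zero] at h2
  have mem_P (p : Ideal.span {e}) : p.1 * e = p.1 := by
    obtain ⟨r, hr⟩ := Ideal.mem_span_singleton'.1 p.2
    rw [← hr, mul_assoc, he.eq]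
  let e' : Ideal.span {e} := ⟨e, Ideal.mem_span_singleton_self e⟩
  refine ⟨Ideal.span {e}, inferInstance, inferInstance,
    (LinearMap.toSpanSingleton R M x).comp (Ideal.span {e}).subtype, ?_, ?_, ?_⟩
  · exact Module.Projective.of_split (Ideal.span {e}).subtype (LinearMap.toSpanSingleton R _ e')
      (LinearMap.ext fun p => Subtype.ext (mem_P p))
  · intro y
    obtain ⟨r, rfl⟩ := hsurj y
    refine ⟨r • e', ?_⟩
    simp [e', mul_smul, hex]
  · intro p hp
    have h1 : π p.1 ∈ Ideal.map π m ⊓ N := by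
      refine ⟨Ideal.mem_map_of_mem _ ((mem_m _).2 (by simpa using hp)), ?_⟩
      rw [← mem_P p, map_mul, hen]
      exact Ideal.mul_mem_left N _ hn
    rw [hN.inf_eq_bot, Submodule.mem_bot] at h1
    have h2 : p = p.1 • e' := Subtype.ext (mem_P p).symm
    rw [h2]
    exact Submodule.smul_mem_smul (Ideal.Quotient.eq_zero_iff_mem.1 h1) Submodule.mem_top

lemma exists_projective_of_isSemisimpleModule (h : PrincipalRightDCC R) (M : Type u)
    [AddCommGroup M] [Module R M] [IsSemisimpleModule R M] :
    ∃ (P : Type u) (_ : AddCommGroup P) (_ : Module R P) (f : P →ₗ[R] M),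
      Module.Projective R P ∧ Function.Surjective f ∧
      LinearMap.ker f ≤ Ring.jacobson R • (⊤ : Submodule R P) := by
  classical
  obtain ⟨s, e, -, hs⟩ := IsSemisimpleModule.exists_linearEquiv_dfinsupp R M
  choose P iP iP' f hP hf hker using
    fun m : s => h.exists_projective_of_isSimpleModule m.1
  refine ⟨Π₀ m : s, P m, inferInstance, inferInstance,
    e.symm.toLinearMap.comp (DFinsupp.mapRange.linearMap f), inferInstance, ?_, ?_⟩
  · refine e.symm.surjective.comp ?_
    exact (DFinsupp.mapRange_surjective _ fun i => map_zero (f i)).2 hf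
  · intro x hx
    have hx0 : DFinsupp.mapRange.linearMap f x = 0 := by simpa using hx
    rw [← DFinsupp.sum_single (f := x)]
    refine Submodule.sum_mem _ fun m _ => ?_
    have h1 : x m ∈ LinearMap.ker (f m) := DFunLike.congr_fun hx0 m
    have h2 := Submodule.mem_map_of_mem (f := DFinsupp.lsingle (R := R) m) (hker m h1)
    rw [Submodule.map_smul''] at h2
    exact Submodule.smul_mono le_rfl le_top h2

theorem hasProjectiveCovers (h : PrincipalRightDCC R) : HasProjectiveCovers R := by
  intro M _ _
  let JM := Ring.jacobson R • (⊤ : Submodule R M)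
  have := h.isSemisimpleRing_quotient
  have htors : Module.IsTorsionBySet R (M ⧸ JM) (Ring.jacobson R) := by
    rw [Module.isTorsionBySet_quotient_iff]
    exact fun x r hr => Submodule.smul_mem_smul hr Submodule.mem_top
  have hss : IsSemisimpleModule R (M ⧸ JM) := by
    let _ := htors.module
    exact htors.isSemisimpleModule_iff.1 inferInstance
  obtain ⟨P, _, _, f, hP, hf, hker⟩ := h.exists_projective_of_isSemisimpleModule (M ⧸ JM)
  obtain ⟨g, hg⟩ := Module.projective_lifting_property JM.mkQ f JM.mkQ_surjective
  refine ⟨P, inferInstance, inferInstance, g, hP, ?_, fun N hN => ?_⟩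
  · rw [← LinearMap.range_eq_top]
    apply h.eq_top_of_sup_jacobson_smul_top
    rw [eq_top_iff]
    intro y _
    obtain ⟨p, hp⟩ := hf (JM.mkQ y)
    rw [← hg, LinearMap.comp_apply, ← sub_eq_zero, ← map_sub, Submodule.mkQ_apply,
      Submodule.Quotient.mk_eq_zero] at hp
    rw [← sub_sub_cancel (g p) y]
    exact Submodule.sub_mem_sup (LinearMap.mem_range_self g p) hp
  · apply h.eq_top_of_sup_jacobson_smul_top
    refine eq_top_iff.2 (hN.ge.trans (sup_le_sup_left (le_trans ?_ hker) N))
    rw [← hg]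
    exact LinearMap.ker_le_ker_comp g JM.mkQ

end PrincipalRightDCC

/-! ### Vanishing of the big finitistic dimension over perfect rings -/

lemma op_mem_jacobson {R : Type u} [Ring R] {j : R} (hj : j ∈ Ring.jacobson R) :
    op j ∈ Ring.jacobson Rᵐᵒᵖ := by
  rw [Ring.jacobson_eq_sInf_isMaximal, Submodule.mem_sInf]
  intro m hm
  by_contra hjm
  obtain ⟨y, w, hw, hyw⟩ := Ideal.IsMaximal.exists_inv hm hjm
  have hu := isUnit_one_sub_of_mem_jacobson ((Ring.jacobson R).mul_mem_right y.unop hj)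
  have hw' : w = op (1 - j * y.unop) := by
    rw [op_sub, op_one, op_mul, op_unop, ← hyw]; abel
  exact hm.ne_top (Ideal.eq_top_of_isUnit_mem m hw (hw' ▸ hu.op))

/-- A nonzero projective module has a simple quotient. -/
lemma Module.Projective.exists_surjective_quotient_maximal {R : Type u} [Ring R] (P : Type u)
    [AddCommGroup P] [Module R P] [Module.Projective R P] [Nontrivial P] :
    ∃ (m : Ideal R) (f : P →ₗ[R] R ⧸ m), m.IsMaximal ∧ Function.Surjective f := by
  by_contra! hcon
  obtain ⟨s, hs⟩ := Module.projective_def'.1 ‹Module.Projective R P›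
  have hsJ (x p : P) : s x p ∈ Ring.jacobson R := by
    rw [Ring.jacobson_eq_sInf_isMaximal, Submodule.mem_sInf]
    intro m hm
    have : IsSimpleModule R (R ⧸ m) := isSimpleModule_iff_isCoatom.2 (Ideal.isMaximal_def.1 hm)
    let f : P →ₗ[R] R ⧸ m := m.mkQ.comp ((Finsupp.lapply p).comp s)
    have hf : f = 0 := f.surjective_or_eq_zero.resolve_left (hcon m f hm)
    have : f x = 0 := by rw [hf, LinearMap.zero_apply]
    simpa [f, Submodule.Quotient.mk_eq_zero] using this
  obtain ⟨x, hx⟩ := exists_ne (0 : P)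
  let N : Submodule Rᵐᵒᵖ R := Submodule.span Rᵐᵒᵖ (s x '' (s x).support)
  have hs' (y : P) : Finsupp.linearCombination R id (s y) = y := LinearMap.congr_fun hs y
  have hmem (p : P) : s x p ∈ Ring.jacobson Rᵐᵒᵖ • N := by
    have h1 : s x p = ∑ q ∈ (s x).support, s x q * s q p := by
      conv_lhs => rw [← hs' x, Finsupp.linearCombination_apply, Finsupp.sum]
      simp [map_sum, Finsupp.finsetSum_apply]
    rw [h1]
    refine Submodule.sum_mem _ fun q hq => ?_
    rw [← op_smul_eq_mul]
    exact Submodule.smul_mem_smul (op_mem_jacobson (hsJ q p))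
      (Submodule.subset_span ⟨q, hq, rfl⟩)
  have hN : N = ⊥ := by
    refine Submodule.FG.eq_bot_of_le_jacobson_smul
      (Submodule.fg_span ((s x).support.finite_toSet.image _)) (Submodule.span_le.2 ?_)
    rintro _ ⟨p, -, rfl⟩
    exact hmem p
  apply hx
  rw [← hs' x]
  have : s x = 0 := by
    ext p
    have := hmem p
    rw [hN, Submodule.smul_bot, Submodule.mem_bot] at this
    exact this
  rw [this, map_zero]

/-- If modules with a length one resolution by finitely generated projectives are projective, then
injections between finitely generated projective modules split. -/
lemma exists_leftInverse_of_fgpdLE_one {R : Type u} [Ring R]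
    (H : ∀ (M : Type u) [AddCommGroup M] [Module R M], fgpdLE R 1 M → Module.Projective R M)
    {Q F : Type u} [AddCommGroup Q] [Module R Q] [AddCommGroup F] [Module R F]
    [Module.Projective R Q] [Module.Finite R Q] [Module.Projective R F] [Module.Finite R F]
    (j : Q →ₗ[R] F) (hj : Injective j) : ∃ r : F →ₗ[R] Q, r.comp j = LinearMap.id := by
  let e := LinearEquiv.ofInjective j hj
  have hproj : Module.Projective R (F ⧸ LinearMap.range j) := by
    refine H _ ⟨F, inferInstance, inferInstance, ⟨inferInstance, inferInstance⟩,
      (LinearMap.range j).mkQ, Submodule.mkQ_surjective _, ?_⟩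
    change Module.Projective R (LinearMap.ker (LinearMap.range j).mkQ) ∧
      Module.Finite R (LinearMap.ker (LinearMap.range j).mkQ)
    rw [Submodule.ker_mkQ]
    exact ⟨Module.Projective.of_equiv e, Module.Finite.equiv e⟩
  obtain ⟨s, hs⟩ := Module.projective_lifting_property (LinearMap.range j).mkQ LinearMap.id
    (Submodule.mkQ_surjective _)
  let t : F →ₗ[R] LinearMap.range j :=
    LinearMap.codRestrict _ (LinearMap.id - s.comp (LinearMap.range j).mkQ) fun y => by
      have := LinearMap.congr_fun hs ((LinearMap.range j).mkQ y)
      rw [LinearMap.comp_apply, LinearMap.id_apply] at this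
      refine (Submodule.Quotient.mk_eq_zero _).1 ?_
      rw [← Submodule.mkQ_apply, LinearMap.sub_apply, map_sub, LinearMap.comp_apply, this,
        LinearMap.id_apply, sub_self]
  refine ⟨e.symm.toLinearMap.comp t, LinearMap.ext fun q => ?_⟩
  have h0 : (LinearMap.range j).mkQ (j q) = 0 := by simp
  have h1 : t (j q) = e q := Subtype.ext <| by
    change j q - s ((LinearMap.range j).mkQ (j q)) = j q
    rw [h0, map_zero, sub_zero]
  simp [h1]

lemma exists_leftInverse_of_span_singleton {R : Type u} [Ring R]
    (H : ∀ (M : Type u) [AddCommGroup M] [Module R M], fgpdLE R 1 M → Module.Projective R M)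
    {Q P : Type u} [AddCommGroup Q] [Module R Q] [AddCommGroup P] [Module R P]
    [Module.Projective R Q] [Module.Projective R P] (q : Q) (hq : Submodule.span R {q} = ⊤)
    (j : Q →ₗ[R] P) (hj : Injective j) : ∃ r : P →ₗ[R] Q, r.comp j = LinearMap.id := by
  obtain ⟨s, hs⟩ := Module.projective_def'.1 ‹Module.Projective R P›
  have hs_inj : Injective s := LinearMap.injective_of_comp_eq_id s _ hs
  have : Module.Finite R Q := ⟨⟨{q}, by simpa using hq⟩⟩
  let S : Set P := ((s (j q)).support : Set P)
  have : Finite S := (s (j q)).support.finite_toSet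
  let ρ : (P →₀ R) →ₗ[R] (S →₀ R) := Finsupp.lsubtypeDomain S
  obtain ⟨r, hr⟩ := exists_leftInverse_of_fgpdLE_one H (ρ.comp (s.comp j)) <| by
    rw [injective_iff_map_eq_zero]
    intro y hy
    obtain ⟨c, rfl⟩ := Submodule.mem_span_singleton.1
      (hq ▸ Submodule.mem_top : y ∈ Submodule.span R {q})
    apply hj
    apply hs_inj
    rw [map_zero, map_zero]
    ext p
    by_cases hp : p ∈ S
    · exact DFunLike.congr_fun hy (⟨p, hp⟩ : S)
    · have : s (j q) p = 0 := by simpa [S] using hp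
      simp [this]
  exact ⟨r.comp (ρ.comp s), hr⟩

namespace HasProjectiveCovers

variable {R : Type u} [Ring R]

/-- Over a perfect ring, a nonzero projective module contains a nonzero cyclic projective. -/
lemma exists_injective_span_singleton (h : HasProjectiveCovers R) (P : Type u) [AddCommGroup P]
    [Module R P] [Module.Projective R P] [Nontrivial P] :
    ∃ (Q : Type u) (_ : AddCommGroup Q) (_ : Module R Q) (q : Q) (j : Q →ₗ[R] P),
      Module.Projective R Q ∧ Submodule.span R {q} = ⊤ ∧ q ≠ 0 ∧ Injective j := by
  obtain ⟨m, g, hm, hg⟩ := Module.Projective.exists_surjective_quotient_maximal (R := R) P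
  obtain ⟨Q, _, _, f, hQ, hf, hsup⟩ := h (R ⧸ m) inferInstance inferInstance
  have hsimple : IsSimpleModule R (R ⧸ m) :=
    isSimpleModule_iff_isCoatom.2 (Ideal.isMaximal_def.1 hm)
  have := IsSimpleModule.nontrivial R (R ⧸ m)
  obtain ⟨t, ht⟩ := exists_ne (0 : R ⧸ m)
  obtain ⟨q, rfl⟩ := hf t
  have hq : Submodule.span R {q} = ⊤ := by
    apply hsup
    rw [eq_top_iff]
    intro y _
    obtain ⟨r, hr⟩ := IsSimpleModule.toSpanSingleton_surjective R ht (f y)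
    rw [LinearMap.toSpanSingleton_apply, ← map_smul] at hr
    rw [← add_sub_cancel (r • q) y]
    refine Submodule.add_mem_sup (Submodule.smul_mem _ _ (Submodule.mem_span_singleton_self q)) ?_
    rw [LinearMap.mem_ker, map_sub, hr, sub_self]
  obtain ⟨k, hk⟩ := Module.projective_lifting_property f g hf
  have hk_surj : Surjective k := by
    rw [← LinearMap.range_eq_top]
    apply hsup
    rw [eq_top_iff]
    intro y _
    obtain ⟨p, hp⟩ := hg (f y)
    rw [← hk] at hp
    rw [← add_sub_cancel (k p) y]
    refine Submodule.add_mem_sup (LinearMap.mem_range_self k p) ?_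
    rw [LinearMap.mem_ker, map_sub, ← hp, LinearMap.comp_apply, sub_self]
  obtain ⟨j, hj⟩ := Module.projective_lifting_property k LinearMap.id hk_surj
  exact ⟨Q, inferInstance, inferInstance, q, j, hQ, hq, fun h0 => ht (by rw [h0, map_zero]),
    LinearMap.injective_of_comp_eq_id j k hj⟩

lemma projective_of_pdLE_one (h : HasProjectiveCovers R)
    (H : ∀ (M : Type u) [AddCommGroup M] [Module R M], fgpdLE R 1 M → Module.Projective R M)
    (M : Type u) [AddCommGroup M] [Module R M] (hM : pdLE R 1 M) : Module.Projective R M := by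
  obtain ⟨P, _, _, hP, g, hg, hK⟩ := hM
  replace hK : Module.Projective R (LinearMap.ker g) := hK
  obtain ⟨Q, _, _, f, hQ, hf, hsup⟩ := h M inferInstance inferInstance
  obtain ⟨k, hk⟩ := Module.projective_lifting_property f g hf
  have hk_surj : Surjective k := by
    rw [← LinearMap.range_eq_top]
    apply hsup
    rw [eq_top_iff]
    intro y _
    obtain ⟨p, hp⟩ := hg (f y)
    rw [← hk] at hp
    rw [← add_sub_cancel (k p) y]
    refine Submodule.add_mem_sup (LinearMap.mem_range_self k p) ?_
    rw [LinearMap.mem_ker, map_sub, ← hp, LinearMap.comp_apply, sub_self]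
  obtain ⟨s, hs⟩ := Module.projective_lifting_property k LinearMap.id hk_surj
  have hks (y : Q) : k (s y) = y := LinearMap.congr_fun hs y
  have hfk (p : P) : f (k p) = g p := LinearMap.congr_fun hk p
  have hker : Module.Projective R (LinearMap.ker f) :=
    Module.Projective.of_split
      (s.restrict (p := LinearMap.ker f) (q := LinearMap.ker g) fun y hy => by
        rw [LinearMap.mem_ker, ← hfk, hks]; exact hy)
      (k.restrict (p := LinearMap.ker g) (q := LinearMap.ker f) fun y hy => by
        rw [LinearMap.mem_ker, hfk]; exact hy)
      (LinearMap.ext fun y => Subtype.ext (hks y))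
  suffices hsub : Subsingleton (LinearMap.ker f) by
    have hinj : Injective f := LinearMap.ker_eq_bot.1 (Submodule.subsingleton_iff_eq_bot.1 hsub)
    exact Module.Projective.of_equiv (LinearEquiv.ofBijective f ⟨hinj, hf⟩)
  by_contra hne
  rw [not_subsingleton_iff_nontrivial] at hne
  obtain ⟨L, _, _, q, j, hL, hq, hq0, hj⟩ := h.exists_injective_span_singleton (LinearMap.ker f)
  obtain ⟨r, hr⟩ := exists_leftInverse_of_span_singleton H q hq
    ((LinearMap.ker f).subtype.comp j) ((Submodule.subtype_injective _).comp hj)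
  have hr' (y : L) : r (j y) = y := LinearMap.congr_fun hr y
  have htop : LinearMap.ker r = ⊤ := by
    apply hsup
    rw [eq_top_iff]
    intro y _
    rw [← sub_add_cancel y (j (r y) : Q)]
    refine Submodule.add_mem_sup ?_ (j (r y)).2
    rw [LinearMap.mem_ker, map_sub, hr', sub_self]
  apply hq0
  rw [← hr' q]
  exact LinearMap.mem_ker.1 (htop ▸ Submodule.mem_top)

end HasProjectiveCovers

/-! ### Finitistic dimensions -/

lemma projective_of_pdLE {R : Type u} [Ring R]
    (H : ∀ (M : Type u) [AddCommGroup M] [Module R M], pdLE R 1 M → Module.Projective R M)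
    (n : ℕ) (M : Type u) [AddCommGroup M] [Module R M] (hM : pdLE R n M) :
    Module.Projective R M := by
  induction n generalizing M with
  | zero => exact hM
  | succ n ih =>
    obtain ⟨P, _, _, hP, f, hf, hker⟩ := hM
    exact H M ⟨P, _, _, hP, f, hf, ih _ hker⟩

lemma fgpdLE.pdLE {R : Type u} [Ring R] (n : ℕ) (M : Type u) [AddCommGroup M] [Module R M]
    (hM : fgpdLE R n M) : pdLE R n M := by
  induction n generalizing M with
  | zero => exact hM.1
  | succ n ih =>
    obtain ⟨P, _, _, hP, f, hf, hker⟩ := hM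
    exact ⟨P, _, _, hP.1, f, hf, ih _ hker⟩

lemma projDim_eq_zero_iff {R : Type u} [Ring R] (M : Type u) [AddCommGroup M] [Module R M] :
    projDim R M = 0 ↔ Module.Projective R M := by
  constructor
  · intro h
    have hne : {d : ℕ∞ | ∃ n : ℕ, d = n ∧ pdLE R n M}.Nonempty := by
      by_contra hempty
      rw [Set.not_nonempty_iff_eq_empty] at hempty
      rw [projDim, hempty, sInf_empty] at h
      exact absurd h (by simp)
    obtain ⟨n, hn, hpd⟩ := csInf_mem hne
    rw [← projDim, h] at hn
    obtain rfl : n = 0 := by exact_mod_cast hn.symm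
    exact hpd
  · exact fun h => le_antisymm (sInf_le ⟨0, by simp, h⟩) bot_le

lemma projDim_ne_top_iff {R : Type u} [Ring R] (M : Type u) [AddCommGroup M] [Module R M] :
    projDim R M ≠ ⊤ ↔ ∃ n, pdLE R n M := by
  constructor
  · intro h
    by_contra! hcon
    apply h
    rw [projDim, sInf_eq_top]
    rintro _ ⟨n, rfl, hn⟩
    exact absurd hn (hcon n)
  · rintro ⟨n, hn⟩
    have h : projDim R M ≤ (n : ℕ∞) := sInf_le ⟨n, rfl, hn⟩
    exact (h.trans_lt (ENat.natCast_lt_top n)).ne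

lemma bigFinDimLeft_eq_zero_iff {R : Type u} [Ring R] :
    bigFinDimLeft R = 0 ↔
      ∀ (M : Type u) [AddCommGroup M] [Module R M], pdLE R 1 M → Module.Projective R M := by
  rw [bigFinDimLeft, ← bot_eq_zero, sSup_eq_bot]
  constructor
  · intro h M _ _ hM
    exact (projDim_eq_zero_iff M).1
      (h _ ⟨(projDim_ne_top_iff M).2 ⟨1, hM⟩, M, inferInstance, inferInstance, rfl⟩)
  · rintro H _ ⟨hd, M, _, _, rfl⟩
    obtain ⟨n, hn⟩ := (projDim_ne_top_iff M).1 hd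
    exact (projDim_eq_zero_iff M).2 (projective_of_pdLE H n M hn)

lemma smallFinDimLeft_eq_zero_iff {R : Type u} [Ring R] :
    smallFinDimLeft R = 0 ↔ ∀ (M : Type u) [AddCommGroup M] [Module R M],
      ∀ n, fgpdLE R n M → Module.Projective R M := by
  rw [smallFinDimLeft, ← bot_eq_zero, sSup_eq_bot]
  constructor
  · intro h M _ _ n hM
    exact (projDim_eq_zero_iff M).1 (h _ ⟨M, inferInstance, inferInstance, ⟨n, hM⟩, rfl⟩)
  · rintro H _ ⟨M, _, _, ⟨n, hn⟩, rfl⟩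
    exact (projDim_eq_zero_iff M).2 (H M n hn)

/-- For a ring `A`, the big finitistic dimension
`Fin.dim A` (computed with right `A`-modules) vanishes if and only if `A` is
right perfect and the small finitistic dimension `fin.dim A` vanishes. -/
theorem bigFinDim_eq_zero_iff_rightPerfect_and_finDim_eq_zero (A : Type u) [Ring A] :
    bigFinDim A = 0 ↔ IsRightPerfect A ∧ finDim A = 0 := by
  rw [bigFinDim, finDim, bigFinDimLeft_eq_zero_iff, smallFinDimLeft_eq_zero_iff]
  constructor
  · intro H
    exact ⟨(principalRightDCC_of_pdLE_one H).hasProjectiveCovers,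
      fun M _ _ n hn => projective_of_pdLE H n M (fgpdLE.pdLE n M hn)⟩
  · rintro ⟨hperf, H⟩ M _ _ hM
    exact HasProjectiveCovers.projective_of_pdLE_one hperf (fun N _ _ => H N 1) M hM
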